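/- For all integers m, n, k, j ≥ 0 and 1 ≤ r ≤ m with m+1 ≥ r + k, the (area, bounce) q,t-enumerators of doubly decorated reduced polyominoes satisfy the recursion RP_{q,t}(m∖r, n)^{∘k,j} = t^{m−r−k+1} Σ_{w=0}^{r} Σ_{s=0}^{n} q^{binom(w,2)} qbinom(r, w)_q qbinom(r+s−w−1, s−w)_q · RP_{q,t}((n−1)∖s, m−r+1)^{∘(j−w), k}, where binom(w,2) = w(w−1)/2. -/

import Mathlib

open Finset

attribute [local instance] Classical.propDecidable

noncomputable section

/-- The ring of polynomials in the two variables `q` and `t` with integer coefficients. -/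
abbrev R2 : Type := MvPolynomial (Fin 2) ℤ

/-- The variable `q`. -/
def qv : R2 := MvPolynomial.X 0

/-- The variable `t`. -/
def tv : R2 := MvPolynomial.X 1

/-- The Gaussian binomial coefficient `[N choose k]_q`, defined via the q-Pascal
recursion `[N+1, k+1]_q = [N, k]_q + q^(k+1) [N, k+1]_q`; it agrees with
`[N]_q! / ([k]_q! [N-k]_q!)` for `0 ≤ k ≤ N` and vanishes for `k > N`. -/
def qBinom : ℕ → ℕ → R2
  | _, 0 => 1
  | 0, _ + 1 => 0
  | N + 1, k + 1 => qBinom N k + qv ^ (k + 1) * qBinom N (k + 1)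

/-- The Gaussian binomial coefficient with integer arguments:
it is `0` unless `0 ≤ k ≤ N`. -/
def qBinomZ (N k : ℤ) : R2 :=
  if 0 ≤ k ∧ k ≤ N then qBinom N.toNat k.toNat else 0

/-! ## Dyck paths as step words

A lattice path is encoded as a word `w : Fin L → Bool`, where `true` is a north
step and `false` is an east step. -/

/-- The number of north steps among the first `k` steps. -/
def nBef {L : ℕ} (w : Fin L → Bool) (k : ℕ) : ℕ :=
  (univ.filter fun i : Fin L => i.1 < k ∧ w i = true).card

/-- The number of east steps among the first `k` steps. -/
def eBef {L : ℕ} (w : Fin L → Bool) (k : ℕ) : ℕ :=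
  (univ.filter fun i : Fin L => i.1 < k ∧ w i = false).card

/-- `w` is the step word of a Dyck path of size `N`: it has `N` north steps
(hence `N` east steps) and every prefix has at least as many norths as easts,
i.e. the path stays weakly above the main diagonal. -/
def IsDyckStep (N : ℕ) (w : Fin (2 * N) → Bool) : Prop :=
  nBef w (2 * N) = N ∧ ∀ k : ℕ, k ≤ 2 * N → eBef w k ≤ nBef w k

/-- A valley: a north step directly preceded by an east step. -/
def IsValleyS {L : ℕ} (w : Fin L → Bool) (i : Fin L) : Prop :=
  w i = true ∧ ∃ j : Fin L, i.1 = j.1 + 1 ∧ w j = false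

/-- A peak: a north step followed by an east step, or the last (north) step. -/
def IsPeakS {L : ℕ} (w : Fin L → Bool) (i : Fin L) : Prop :=
  w i = true ∧ ∀ j : Fin L, j.1 = i.1 + 1 → w j = false

/-- A fall: an east step immediately followed by another east step. -/
def IsFallS {L : ℕ} (w : Fin L → Bool) (i : Fin L) : Prop :=
  w i = false ∧ ∃ j : Fin L, j.1 = i.1 + 1 ∧ w j = false

/-- A fall, where additionally the last step of the path is allowed. -/
def IsFallX {L : ℕ} (w : Fin L → Bool) (i : Fin L) : Prop :=
  w i = false ∧ (i.1 + 1 = L ∨ ∃ j : Fin L, j.1 = i.1 + 1 ∧ w j = false)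

/-! ## Reduced parallelogram polyominoes: pair-of-paths model

A reduced polyomino of size `m × n` is a pair of lattice paths (red and green,
`true` = north, `false` = east) from `(0,0)` to `(m,n)`, the red one lying
always weakly above the green one. -/

/-- The number of north steps of `w` before its `c`-th east step (for `c` larger
than the number of east steps, this is the total number of north steps). -/
def Yval {L : ℕ} (w : Fin L → Bool) (c : ℕ) : ℕ :=
  (univ.filter fun i : Fin L => w i = true ∧ eBef w i.1 < c).card

/-- The number of east steps of `w` before its `k`-th north step (for `k` larger
than the number of north steps, this is the total number of east steps). -/
def Xval {L : ℕ} (w : Fin L → Bool) (k : ℕ) : ℕ :=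
  (univ.filter fun i : Fin L => w i = false ∧ nBef w i.1 < k).card

/-- `(red, green)` is a pair of paths from `(0,0)` to `(m,n)` with red weakly
above green. -/
def IsRPPair (m n : ℕ) (red green : Fin (m + n) → Bool) : Prop :=
  nBef red (m + n) = n ∧ nBef green (m + n) = n ∧
    ∀ k : ℕ, k ≤ m + n → nBef green k ≤ nBef red k

/-- A green peak: a horizontal green step immediately following a vertical
green step. -/
def IsGreenPeak {L : ℕ} (g : Fin L → Bool) (i : Fin L) : Prop :=
  g i = false ∧ ∃ j : Fin L, i.1 = j.1 + 1 ∧ g j = true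

/-- A red valley: a vertical red step immediately following a horizontal red
step; the first red step counts as a valley if it is vertical. -/
def IsRedValley {L : ℕ} (w : Fin L → Bool) (i : Fin L) : Prop :=
  w i = true ∧ (i.1 = 0 ∨ ∃ j : Fin L, i.1 = j.1 + 1 ∧ w j = false)

/-- Candidate objects: (red path, green path, decorated green peaks,
decorated red valleys). -/
abbrev RPoCand (m n : ℕ) :=
  (Fin (m + n) → Bool) × (Fin (m + n) → Bool) × Finset (Fin (m + n)) × Finset (Fin (m + n))

/-- The `k`-th corner `(p_k, h_k)` of the bounce path of a reduced polyomino: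
starting at `(0,0)` it goes east until the beginning of a vertical green step,
north until the beginning of a horizontal red step, and so on, bouncing at the
beginning of a step of either path. -/
def bncP {L : ℕ} (red green : Fin L → Bool) : ℕ → ℕ × ℕ
  | 0 => (0, 0)
  | k + 1 =>
    let p' := Xval green ((bncP red green k).2 + 1)
    (p', Yval red (p' + 1))

/-- The letter (disregarding the bar) of the bounce word carried by the
vertical bounce step in row `y`. -/
def vLabel {L : ℕ} (red green : Fin L → Bool) (y : ℕ) : ℕ :=
  ((Finset.Icc 1 L).filter fun k => (bncP red green k).2 ≤ y).card

/-- The letter of the bounce word carried by the horizontal bounce step in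
column `c`. -/
def hLabel {L : ℕ} (red green : Fin L → Bool) (c : ℕ) : ℕ :=
  ((Finset.Icc 1 L).filter fun k => (bncP red green k).1 ≤ c).card

/-- The area: the sum of the letters of the area word of the polyomino
disregarding bars, i.e. the number of whole squares lying between the two
paths. -/
def areaRPo {m n : ℕ} (x : RPoCand m n) : ℕ :=
  ∑ c ∈ Finset.Icc 1 m, (Yval x.1 c - Yval x.2.1 c)

/-- The bounce: the sum of the letters of the bounce word disregarding bars,
not counting the barred letters (vertical bounce steps) lying in the same row
as a decorated red valley, nor the unbarred letters (horizontal bounce steps)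
lying in the same column as a decorated green peak. -/
def bounceRPo {m n : ℕ} (x : RPoCand m n) : ℕ :=
  (∑ y ∈ (Finset.range n).filter
      (fun y => y ∉ x.2.2.2.image fun i => nBef x.1 i.1), vLabel x.1 x.2.1 y) +
    ∑ c ∈ (Finset.range m).filter
      (fun c => c ∉ x.2.2.1.image fun i => eBef x.2.1 i.1), hLabel x.1 x.2.1 c

/-- Membership in `RP(m∖r, n)^{∘k, j}`: a reduced polyomino of size `m × n`
with `k` decorated green peaks, `j` decorated red valleys, and exactly `r-1`
letters equal to `0` in the bounce word (the `0` letters of the bounce word are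
the horizontal steps of its initial east run). -/
def IsRPo (m n r k j : ℕ) (x : RPoCand m n) : Prop :=
  IsRPPair m n x.1 x.2.1 ∧
    (∀ i ∈ x.2.2.1, IsGreenPeak x.2.1 i) ∧ x.2.2.1.card = k ∧
    (∀ i ∈ x.2.2.2, IsRedValley x.1 i) ∧ x.2.2.2.card = j ∧
    Xval x.2.1 1 + 1 = r

/-- The `(area, bounce)` q,t-enumerator `RP_{q,t}(m∖r, n)^{∘k, j}`;
it is `0` if some parameter is negative. -/
def RPoE (m n r k j : ℤ) : R2 :=
  if 0 ≤ m ∧ 0 ≤ n ∧ 0 ≤ r ∧ 0 ≤ k ∧ 0 ≤ j then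
    ∑ x ∈ univ.filter (IsRPo m.toNat n.toNat r.toNat k.toNat j.toNat),
      qv ^ areaRPo x * tv ^ bounceRPo x
  else 0

/-! ## Lattice path words -/

/-- The path with north and east steps exchanged. -/
def tr {L : ℕ} (w : Fin L → Bool) : Fin L → Bool := fun i => !(w i)

theorem tr_tr {L : ℕ} (w : Fin L → Bool) : tr (tr w) = w := by
  funext i; simp [tr]

theorem nBef_tr {L : ℕ} (w : Fin L → Bool) (k : ℕ) : nBef (tr w) k = eBef w k := by
  simp [tr, nBef, eBef]

theorem eBef_tr {L : ℕ} (w : Fin L → Bool) (k : ℕ) : eBef (tr w) k = nBef w k := by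
  simp [tr, nBef, eBef]

theorem Yval_tr {L : ℕ} (w : Fin L → Bool) (k : ℕ) : Yval (tr w) k = Xval w k := by
  simp only [Yval, Xval, eBef_tr]
  simp [tr]

theorem nBef_mono {L : ℕ} (w : Fin L → Bool) : Monotone (nBef w) := by
  intro a b h
  refine card_le_card fun i hi => ?_
  simp only [mem_filter, mem_univ, true_and] at hi ⊢
  exact ⟨by omega, hi.2⟩

theorem eBef_mono {L : ℕ} (w : Fin L → Bool) : Monotone (eBef w) := by
  intro a b h
  simpa only [nBef_tr] using nBef_mono (tr w) h

theorem Yval_mono {L : ℕ} (w : Fin L → Bool) : Monotone (Yval w) := by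
  intro a b h
  refine card_le_card fun i hi => ?_
  simp only [mem_filter, mem_univ, true_and] at hi ⊢
  exact ⟨hi.1, by omega⟩

theorem nBef_succ {L : ℕ} (w : Fin L → Bool) (i : Fin L) :
    nBef w (i.1 + 1) = nBef w i.1 + if w i = true then 1 else 0 := by
  unfold nBef
  split_ifs with h
  · rw [← card_insert_of_notMem (a := i) (by simp)]
    congr 1
    ext x
    simp only [mem_filter, mem_univ, true_and, mem_insert]
    constructor
    · rintro ⟨h1, h2⟩
      by_cases hx : x = i
      · exact Or.inl hx
      · exact Or.inr ⟨by have := Fin.val_ne_of_ne hx; omega, h2⟩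
    · rintro (rfl | ⟨h1, h2⟩)
      · exact ⟨by omega, h⟩
      · exact ⟨by omega, h2⟩
  · rw [add_zero]
    congr 1
    ext x
    simp only [mem_filter, mem_univ, true_and]
    refine ⟨fun ⟨h1, h2⟩ => ⟨?_, h2⟩, fun ⟨h1, h2⟩ => ⟨by omega, h2⟩⟩
    have : x ≠ i := by rintro rfl; exact h h2
    have := Fin.val_ne_of_ne this
    omega

theorem eBef_succ {L : ℕ} (w : Fin L → Bool) (i : Fin L) :
    eBef w (i.1 + 1) = eBef w i.1 + if w i = false then 1 else 0 := by
  rw [← nBef_tr, ← nBef_tr, nBef_succ]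
  simp [tr]

theorem nBef_zero {L : ℕ} (w : Fin L → Bool) : nBef w 0 = 0 := by simp [nBef]

theorem eBef_zero {L : ℕ} (w : Fin L → Bool) : eBef w 0 = 0 := by simp [eBef]

theorem eBef_add_nBef {L : ℕ} (w : Fin L → Bool) {k : ℕ} (hk : k ≤ L) :
    eBef w k + nBef w k = k := by
  induction k with
  | zero => simp [nBef_zero, eBef_zero]
  | succ k ih =>
    have h1 := nBef_succ w ⟨k, hk⟩
    have h2 := eBef_succ w ⟨k, hk⟩
    have := ih (by omega)
    cases hw : w ⟨k, hk⟩ <;> simp [hw] at h1 h2 <;> omega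

theorem nBef_le_Yval {L : ℕ} (w : Fin L → Bool) (k : ℕ) :
    nBef w k ≤ Yval w (eBef w k + 1) := by
  refine card_le_card fun i hi => ?_
  simp only [mem_filter, mem_univ, true_and] at hi ⊢
  have := eBef_mono w hi.1.le
  exact ⟨hi.2, by omega⟩

theorem Yval_le_nBef {L : ℕ} (w : Fin L → Bool) {c k : ℕ} (h : c ≤ eBef w k) :
    Yval w c ≤ nBef w k := by
  refine card_le_card fun i hi => ?_
  simp only [mem_filter, mem_univ, true_and] at hi ⊢
  refine ⟨?_, hi.1⟩
  by_contra hk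
  have := eBef_mono w (not_lt.mp hk)
  omega

theorem exists_north_step {L : ℕ} (w : Fin L → Bool) {y : ℕ} (h : y < nBef w L) :
    ∃ i : Fin L, nBef w i.1 = y ∧ w i = true := by
  have hex : ∃ k, y < nBef w k := ⟨L, h⟩
  obtain ⟨k, hk, hmin⟩ : ∃ k, y < nBef w k ∧ ∀ k' < k, nBef w k' ≤ y :=
    ⟨Nat.find hex, Nat.find_spec hex, fun k' h' => not_lt.mp (Nat.find_min hex h')⟩
  have hkL : k ≤ L := by
    by_contra hc
    have := hmin L (by omega)
    omega
  obtain _ | k := k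
  · simp [nBef_zero] at hk
  have h1 := nBef_succ w ⟨k, hkL⟩
  have h2 := hmin k (by omega)
  cases hw : w ⟨k, hkL⟩ <;> simp [hw] at h1
  · omega
  · exact ⟨⟨k, hkL⟩, by simp; omega, hw⟩

theorem exists_east_step {L : ℕ} (w : Fin L → Bool) {y : ℕ} (h : y < eBef w L) :
    ∃ i : Fin L, eBef w i.1 = y ∧ w i = false := by
  obtain ⟨i, h1, h2⟩ := exists_north_step (tr w) (y := y) (by rwa [nBef_tr])
  exact ⟨i, by rwa [nBef_tr] at h1, by simpa [tr] using h2⟩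

/-- The height of an east step is recorded by `Yval`. -/
theorem Yval_of_east {L : ℕ} (w : Fin L → Bool) {i : Fin L} (hi : w i = false) :
    Yval w (eBef w i.1 + 1) = nBef w i.1 := by
  apply le_antisymm
  · have h1 : nBef w (i.1 + 1) = nBef w i.1 := by simp [nBef_succ, hi]
    rw [← h1]
    apply Yval_le_nBef
    simp [eBef_succ, hi]
  · exact nBef_le_Yval w i.1

theorem Xval_of_north {L : ℕ} (w : Fin L → Bool) {i : Fin L} (hi : w i = true) :
    Xval w (nBef w i.1 + 1) = eBef w i.1 := by
  have := Yval_of_east (tr w) (i := i) (by simp [tr, hi])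
  rwa [Yval_tr, eBef_tr, nBef_tr] at this

theorem Yval_le_iff {L : ℕ} (w : Fin L → Bool) {y : ℕ} (hy : y < nBef w L) (c : ℕ) :
    Yval w (c + 1) ≤ y ↔ c < Xval w (y + 1) := by
  obtain ⟨i, rfl, hi⟩ := exists_north_step w hy
  rw [Xval_of_north w hi]
  constructor
  · intro h
    by_contra hc
    have h1 := nBef_le_Yval w (i.1 + 1)
    have h2 : eBef w (i.1 + 1) = eBef w i.1 := by simp [eBef_succ, hi]
    have h3 : nBef w (i.1 + 1) = nBef w i.1 + 1 := by simp [nBef_succ, hi]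
    have := Yval_mono w (show eBef w i.1 + 1 ≤ c + 1 by omega)
    rw [h2] at h1
    omega
  · exact fun h => Yval_le_nBef w h

theorem Yval_le {L : ℕ} (w : Fin L → Bool) (c : ℕ) : Yval w c ≤ nBef w L := by
  refine card_le_card fun i hi => ?_
  simp only [mem_filter, mem_univ, true_and] at hi ⊢
  exact ⟨i.2, hi.1⟩

theorem above_iff {L : ℕ} (red green : Fin L → Bool) (h : nBef red L = nBef green L) :
    (∀ k ≤ L, nBef green k ≤ nBef red k) ↔
      ∀ y < nBef red L, y + 1 ≤ Yval red (Xval green (y + 1) + 1) := by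
  constructor
  · intro hab y hy
    obtain ⟨i, rfl, hi⟩ := exists_north_step green (y := y) (by omega)
    rw [Xval_of_north green hi]
    have h1 := hab (i.1 + 1) i.2
    have h3 : nBef green (i.1 + 1) = nBef green i.1 + 1 := by simp [nBef_succ, hi]
    have h4 := eBef_add_nBef green (k := i.1 + 1) i.2
    have h5 := eBef_add_nBef red (k := i.1 + 1) i.2
    have h2 : eBef green (i.1 + 1) = eBef green i.1 := by simp [eBef_succ, hi]
    have h6 := nBef_le_Yval red (i.1 + 1)
    have := Yval_mono red (show eBef red (i.1 + 1) + 1 ≤ eBef green i.1 + 1 by omega)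
    omega
  · intro hc k hk
    by_contra hlt
    have h4 := eBef_add_nBef green hk
    have h5 := eBef_add_nBef red hk
    have h7 := nBef_mono green hk
    have h1 := hc (nBef green k - 1) (by omega)
    have h2 : Xval green (nBef green k - 1 + 1) ≤ eBef green k := by
      rw [← Yval_tr, ← nBef_tr]
      apply Yval_le_nBef
      rw [eBef_tr]
      omega
    have h3 := Yval_mono red (Nat.succ_le_succ h2)
    have h6 : Yval red (eBef green k + 1) ≤ nBef red k := Yval_le_nBef red (by omega)
    simp only [Nat.succ_eq_add_one] at h3
    omega

/-! ## Encoding of a path by its column heights -/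

/-- Partial sums. -/
def cum (f : ℕ → ℕ) (c : ℕ) : ℕ := ∑ i ∈ range c, f i

theorem cum_zero (f : ℕ → ℕ) : cum f 0 = 0 := rfl

theorem cum_succ (f : ℕ → ℕ) (c : ℕ) : cum f (c + 1) = cum f c + f c := sum_range_succ f c

theorem cum_mono (f : ℕ → ℕ) : Monotone (cum f) :=
  monotone_nat_of_le_succ fun c => by rw [cum_succ]; omega

/-- The number of north steps with given abscissa. -/
def enc {L : ℕ} (w : Fin L → Bool) (c : ℕ) : ℕ :=
  (univ.filter fun i : Fin L => w i = true ∧ eBef w i.1 = c).card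

theorem cum_enc {L : ℕ} (w : Fin L → Bool) (c : ℕ) : cum (enc w) c = Yval w c := by
  unfold cum Yval enc
  rw [card_eq_sum_card_fiberwise (f := fun i : Fin L => eBef w i.1) (t := range c)]
  · refine sum_congr rfl fun d hd => ?_
    congr 1
    ext i
    simp only [mem_filter, mem_univ, true_and]
    have := mem_range.mp hd
    constructor
    · rintro ⟨h1, h2⟩; exact ⟨⟨h1, by omega⟩, h2⟩
    · rintro ⟨⟨h1, h2⟩, h3⟩; exact ⟨h1, h3⟩
  · intro i hi
    simpa using (mem_filter.mp hi).2.2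

theorem cum_enc_eq {L m : ℕ} (w : Fin L → Bool) (hm : eBef w L = m) {c : ℕ} (hc : m < c) :
    cum (enc w) c = nBef w L := by
  rw [cum_enc]
  apply le_antisymm (Yval_le w c)
  exact (nBef_le_Yval w L).trans (Yval_mono w (by omega))

theorem enc_eq_zero {L : ℕ} (w : Fin L → Bool) {c : ℕ} (hc : enc w c ≠ 0) :
    c ≤ eBef w L := by
  obtain ⟨i, hi⟩ := card_ne_zero.mp hc
  obtain ⟨-, -, rfl⟩ := mem_filter.mp hi
  exact eBef_mono w i.2.le

theorem eq_false_iff {L : ℕ} (w : Fin L → Bool) (i : Fin L) :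
    w i = false ↔ ∃ c < eBef w L, i.1 = c + Yval w (c + 1) := by
  constructor
  · intro h
    refine ⟨eBef w i.1, ?_, ?_⟩
    · have := eBef_mono w (show i.1 + 1 ≤ L from i.2)
      simp [eBef_succ, h] at this
      omega
    · rw [Yval_of_east w h, eBef_add_nBef w i.2.le]
  · rintro ⟨c, hc, hi⟩
    obtain ⟨i', rfl, hi'⟩ := exists_east_step w hc
    rw [Yval_of_east w hi', eBef_add_nBef w i'.2.le] at hi
    rwa [Fin.ext hi]

theorem enc_injective {L : ℕ} {w w' : Fin L → Bool} (hE : eBef w L = eBef w' L)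
    (h : enc w = enc w') : w = w' := by
  funext i
  have : w i = false ↔ w' i = false := by
    rw [eq_false_iff, eq_false_iff, hE]
    simp only [← cum_enc, h]
  cases h1 : w i <;> cases h2 : w' i <;> simp_all

theorem exists_enc {L m n : ℕ} (hL : L = m + n) (f : ℕ → ℕ) (hf : cum f (m + 1) = n)
    (hs : ∀ i, f i ≠ 0 → i < m + 1) :
    ∃ w : Fin L → Bool, eBef w L = m ∧ nBef w L = n ∧ enc w = f := by
  subst hL
  set e : ℕ → ℕ := fun c => c + cum f (c + 1) with he
  have hmono : StrictMono e := by
    refine strictMono_nat_of_lt_succ fun c => ?_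
    have := cum_mono f (show c + 1 ≤ c + 1 + 1 by omega)
    simp only [he]
    omega
  have hem : e m = m + n := by simp [he, hf]
  set w : Fin (m + n) → Bool := fun i => decide (¬ ∃ c, i.1 = e c) with hw
  have key : ∀ c ≤ m, eBef w (e c) = c := by
    intro c hc
    have : (univ.filter fun i : Fin (m + n) => i.1 < e c ∧ w i = false).map Fin.valEmbedding
        = (range c).image e := by
      ext x
      simp only [mem_map, mem_filter, mem_univ, true_and, mem_image, mem_range, hw,
        decide_eq_false_iff_not, not_not]
      constructor
      · rintro ⟨i, ⟨h1, d, h2⟩, rfl⟩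
        exact ⟨d, hmono.lt_iff_lt.mp (by rw [← h2]; exact h1), h2.symm⟩
      · rintro ⟨d, h1, rfl⟩
        have h2 := hmono h1
        have h3 := hmono.monotone hc
        exact ⟨⟨e d, by omega⟩, ⟨h2, d, rfl⟩, rfl⟩
    unfold eBef
    rw [← card_map Fin.valEmbedding, this, card_image_of_injective _ hmono.injective, card_range]
  have hE : eBef w (m + n) = m := by simpa only [hem] using key m le_rfl
  have hN : nBef w (m + n) = n := by
    have := eBef_add_nBef w (k := m + n) le_rfl
    omega
  have hY : ∀ c, cum (enc w) c = cum f c := by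
    intro c
    obtain _ | c := c
    · rfl
    by_cases hc : c < m
    · have hlt := hmono hc
      have hi : w ⟨e c, by omega⟩ = false := by simp [hw]
      have := Yval_of_east w hi
      simp only [key c hc.le] at this
      rw [cum_enc, this]
      have h2 := eBef_add_nBef w (k := e c) (by omega)
      rw [key c hc.le] at h2
      simp only [he] at h2 ⊢
      omega
    · rw [cum_enc_eq w hE (by omega), hN, ← hf]
      obtain ⟨d, rfl⟩ := Nat.exists_eq_add_of_le (not_lt.mp hc)
      clear hc
      induction d with
      | zero => rfl
      | succ d ih =>
        have h0 : f (m + d + 1) = 0 := by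
          by_contra h
          have := hs _ h
          omega
        rw [show m + (d + 1) + 1 = m + d + 1 + 1 by ring, cum_succ f (m + d + 1), h0, ← ih,
          add_zero]
  refine ⟨w, hE, hN, ?_⟩
  funext c
  have h1 := hY c
  have h2 := hY (c + 1)
  rw [cum_succ, cum_succ] at h2
  omega

/-! ## Decorations -/

theorem redValley_lt {L : ℕ} {w : Fin L → Bool} {i j : Fin L} (hi : IsRedValley w i)
    (hj : w j = true) (h : j < i) : eBef w j.1 < eBef w i.1 := by
  rcases hi.2 with h0 | ⟨l, hl, hw⟩
  · have : j.1 < i.1 := h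
    omega
  · have hjl : j ≠ l := by rintro rfl; simp_all
    have h1 : j.1 < i.1 := h
    have h2 := Fin.val_ne_of_ne hjl
    have h3 := eBef_mono w (show j.1 ≤ l.1 by omega)
    rw [hl, eBef_succ, if_pos hw]
    omega

theorem redValley_injOn {L : ℕ} (w : Fin L → Bool) :
    Set.InjOn (fun i : Fin L => eBef w i.1) {i | IsRedValley w i} := by
  intro i hi j hj h
  simp only at h
  rcases lt_trichotomy i j with hlt | heq | hlt
  · have := redValley_lt hj hi.1 hlt; omega
  · exact heq
  · have := redValley_lt hi hj.1 hlt; omega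

theorem enc_ne_zero_of_redValley {L : ℕ} {w : Fin L → Bool} {i : Fin L}
    (hi : IsRedValley w i) : enc w (eBef w i.1) ≠ 0 :=
  card_ne_zero.mpr ⟨i, by simp [hi.1]⟩

theorem exists_redValley {L : ℕ} {w : Fin L → Bool} {c : ℕ} (hc : enc w c ≠ 0) :
    ∃ i, IsRedValley w i ∧ eBef w i.1 = c := by
  obtain ⟨i, hi, hmin⟩ := exists_min_image _ (fun i : Fin L => i) (card_ne_zero.mp hc)
  simp only [mem_filter, mem_univ, true_and] at hi hmin
  refine ⟨i, ⟨hi.1, ?_⟩, hi.2⟩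
  by_cases h0 : i.1 = 0
  · exact Or.inl h0
  refine Or.inr ⟨⟨i.1 - 1, by omega⟩, by simp; omega, ?_⟩
  by_contra hw
  simp only [Bool.not_eq_false] at hw
  have h1 := eBef_succ w ⟨i.1 - 1, by omega⟩
  simp only [hw, show i.1 - 1 + 1 = i.1 by omega] at h1
  have := hmin _ ⟨hw, by simp at h1 ⊢; omega⟩
  have : i.1 ≤ i.1 - 1 := this
  omega

theorem nBef_redValley {L : ℕ} {w : Fin L → Bool} {i : Fin L} (hi : IsRedValley w i) :
    nBef w i.1 = cum (enc w) (eBef w i.1) := by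
  rw [cum_enc]
  apply le_antisymm
  · refine card_le_card fun j hj => ?_
    simp only [mem_filter, mem_univ, true_and] at hj ⊢
    exact ⟨hj.2, redValley_lt hi hj.2 hj.1⟩
  · exact Yval_le_nBef w le_rfl

theorem greenPeak_iff {L : ℕ} (w : Fin L → Bool) (i : Fin L) :
    IsGreenPeak w i ↔ IsRedValley (tr w) i ∧ eBef (tr w) i.1 ≠ 0 := by
  simp only [IsGreenPeak, IsRedValley, tr, Bool.not_eq_true', Bool.not_eq_false']
  constructor
  · rintro ⟨h, j, hj, hw⟩
    refine ⟨⟨h, Or.inr ⟨j, hj, hw⟩⟩, ?_⟩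
    rw [hj]
    simp [eBef_succ, tr, hw]
  · rintro ⟨⟨h, h0 | h1⟩, h2⟩
    · rw [h0] at h2
      exact absurd (eBef_zero _) h2
    · exact ⟨h, h1⟩

/-! ## Polyominoes as pairs of sequences -/

/-- A decorated polyomino given by the column heights of its red path, the row lengths of its
green path, the rows of its decorated green peaks and the columns of its decorated red valleys. -/
abbrev SeqCand := (ℕ → ℕ) × (ℕ → ℕ) × Finset ℕ × Finset ℕ

/-- The path with column heights `f` is weakly above the one with row lengths `g`. -/
def Above (f g : ℕ → ℕ) (n : ℕ) : Prop :=
  ∀ y < n, y + 1 ≤ cum f (cum g (y + 1) + 1)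

/-- The sequence version of `IsRPo`. -/
structure IsSeqRPo (m n r k j : ℕ) (x : SeqCand) : Prop where
  sum_red : cum x.1 (m + 1) = n
  supp_red : ∀ i, x.1 i ≠ 0 → i < m + 1
  sum_green : cum x.2.1 (n + 1) = m
  supp_green : ∀ i, x.2.1 i ≠ 0 → i < n + 1
  above : Above x.1 x.2.1 n
  peak : ∀ c ∈ x.2.2.1, c ≠ 0 ∧ x.2.1 c ≠ 0
  card_peak : x.2.2.1.card = k
  valley : ∀ c ∈ x.2.2.2, x.1 c ≠ 0
  card_valley : x.2.2.2.card = j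
  first_run : x.2.1 0 + 1 = r

/-- The finite set of all `x` with `IsSeqRPo m n r k j x`. -/
def seqRPo (m n r k j : ℕ) : Finset SeqCand :=
  (piAntidiag (range (m + 1)) n ×ˢ piAntidiag (range (n + 1)) m ×ˢ
    (range (n + 1)).powerset ×ˢ (range (m + 1)).powerset).filter (IsSeqRPo m n r k j)

theorem mem_seqRPo {m n r k j : ℕ} {x : SeqCand} :
    x ∈ seqRPo m n r k j ↔ IsSeqRPo m n r k j x := by
  unfold seqRPo
  rw [mem_filter, and_iff_right_iff_imp]
  intro h
  simp only [mem_product, mem_piAntidiag, mem_powerset, mem_range]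
  exact ⟨⟨h.sum_red, h.supp_red⟩, ⟨h.sum_green, h.supp_green⟩,
    fun c hc => mem_range.mpr (h.supp_green c (h.peak c hc).2),
    fun c hc => mem_range.mpr (h.supp_red c (h.valley c hc))⟩

/-- The corners of the bounce path. -/
def corner (f g : ℕ → ℕ) : ℕ → ℕ × ℕ
  | 0 => (0, 0)
  | k + 1 => (cum g ((corner f g k).2 + 1), cum f (cum g ((corner f g k).2 + 1) + 1))

/-- The label of the vertical bounce step in row `y`, using `L` corners. -/
def vLab (f g : ℕ → ℕ) (L y : ℕ) : ℕ :=
  ((Finset.Icc 1 L).filter fun k => (corner f g k).2 ≤ y).card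

/-- The label of the horizontal bounce step in column `c`, using `L` corners. -/
def hLab (f g : ℕ → ℕ) (L c : ℕ) : ℕ :=
  ((Finset.Icc 1 L).filter fun k => (corner f g k).1 ≤ c).card

/-- The sequence version of `areaRPo`. -/
def seqArea (m n : ℕ) (f g : ℕ → ℕ) : ℕ :=
  ∑ c ∈ range m, ∑ y ∈ range n, if y < cum f (c + 1) ∧ c < cum g (y + 1) then 1 else 0

/-- The contribution of the vertical steps to the bounce. -/
def vSum (n L : ℕ) (x : SeqCand) : ℕ :=
  ∑ y ∈ (range n).filter (fun y => y ∉ x.2.2.2.image (cum x.1)), vLab x.1 x.2.1 L y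

/-- The contribution of the horizontal steps to the bounce. -/
def hSum (m L : ℕ) (x : SeqCand) : ℕ :=
  ∑ c ∈ (range m).filter (fun c => c ∉ x.2.2.1.image (cum x.2.1)), hLab x.1 x.2.1 L c

/-- The enumerator of `seqRPo`. -/
def seqEnum (m n r k j : ℕ) : R2 :=
  ∑ x ∈ seqRPo m n r k j,
    qv ^ seqArea m n x.1 x.2.1 * tv ^ (vSum n (m + n) x + hSum m (m + n) x)

/-- The sequences of a pair of decorated paths. -/
def toSeq {m n : ℕ} (x : RPoCand m n) : SeqCand :=
  (enc x.1, enc (tr x.2.1), x.2.2.1.image fun i => eBef (tr x.2.1) i.1,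
    x.2.2.2.image fun i => eBef x.1 i.1)

theorem corner_enc {L : ℕ} (red green : Fin L → Bool) (k : ℕ) :
    corner (enc red) (enc (tr green)) k = bncP red green k := by
  induction k with
  | zero => rfl
  | succ k ih => simp only [corner, bncP, cum_enc, Yval_tr, ih]

theorem seqArea_toSeq {m n : ℕ} {x : RPoCand m n} (hx : IsRPPair m n x.1 x.2.1) :
    seqArea m n (toSeq x).1 (toSeq x).2.1 = areaRPo x := by
  unfold seqArea areaRPo
  rw [show Finset.Icc 1 m = Finset.Ico 1 (m + 1) from rfl, sum_Ico_eq_sum_range]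
  refine sum_congr rfl fun c _ => ?_
  rw [← card_filter, ← Nat.card_Ico, add_comm 1 c]
  congr 1
  ext y
  simp only [toSeq, mem_filter, mem_range, cum_enc, Yval_tr, mem_Ico]
  have hle := Yval_le x.1 (c + 1)
  rw [hx.1] at hle
  constructor
  · rintro ⟨h1, h2, h3⟩
    exact ⟨(Yval_le_iff x.2.1 (by rw [hx.2.1]; exact h1) c).mpr h3, h2⟩
  · rintro ⟨h1, h2⟩
    have h3 : y < n := by omega
    exact ⟨h3, h2, (Yval_le_iff x.2.1 (by rw [hx.2.1]; exact h3) c).mp h1⟩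

theorem bounce_toSeq {m n r k j : ℕ} {x : RPoCand m n} (hx : IsRPo m n r k j x) :
    vSum n (m + n) (toSeq x) + hSum m (m + n) (toSeq x) = bounceRPo x := by
  obtain ⟨-, hA, -, hB, -⟩ := hx
  have h1 : (toSeq x).2.2.2.image (cum (toSeq x).1) = x.2.2.2.image fun i => nBef x.1 i.1 := by
    simp only [toSeq, image_image]
    exact image_congr fun i hi => (nBef_redValley (hB i hi)).symm
  have h2 : (toSeq x).2.2.1.image (cum (toSeq x).2.1) =
      x.2.2.1.image fun i => eBef x.2.1 i.1 := by
    simp only [toSeq, image_image]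
    refine image_congr fun i hi => ?_
    have := nBef_redValley ((greenPeak_iff _ _).mp (hA i hi)).1
    rw [nBef_tr] at this
    exact this.symm
  unfold vSum hSum bounceRPo
  rw [h1, h2]
  simp only [toSeq, vLab, hLab, corner_enc, vLabel, hLabel]

theorem image_injOn_subsets {α β : Type*} [DecidableEq β] {φ : α → β} {s : Set α}
    (h : Set.InjOn φ s) {A B : Finset α} (hA : ∀ a ∈ A, a ∈ s) (hB : ∀ a ∈ B, a ∈ s) (hAB : A.image φ = B.image φ) :
    A = B := by
  rw [← coe_inj] at hAB ⊢
  rw [coe_image, coe_image] at hAB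
  exact (h.image_eq_image_iff hA hB).mp hAB

theorem toSeq_mem {m n r k j : ℕ} {x : RPoCand m n} (hx : IsRPo m n r k j x) :
    IsSeqRPo m n r k j (toSeq x) := by
  obtain ⟨⟨h1, h2, h3⟩, hA, hk, hB, hj, hr⟩ := hx
  have e1 : eBef x.1 (m + n) = m := by
    have := eBef_add_nBef x.1 (k := m + n) le_rfl; omega
  have e2 : eBef x.2.1 (m + n) = m := by
    have := eBef_add_nBef x.2.1 (k := m + n) le_rfl; omega
  simp only [greenPeak_iff] at hA
  refine ⟨?_, ?_, ?_, ?_, ?_, ?_, ?_, ?_, ?_, ?_⟩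
  · simp only [toSeq]
    rw [cum_enc_eq x.1 e1 (by omega), h1]
  · intro i hi
    have := enc_eq_zero x.1 hi
    omega
  · simp only [toSeq]
    rw [cum_enc_eq (m := n) (tr x.2.1) (by rw [eBef_tr]; exact h2) (by omega), nBef_tr, e2]
  · intro i hi
    have := enc_eq_zero (tr x.2.1) hi
    rw [eBef_tr] at this
    omega
  · have := (above_iff x.1 x.2.1 (h1.trans h2.symm)).mp h3
    rw [h1] at this
    simpa only [Above, toSeq, cum_enc, Yval_tr] using this
  · intro c hc
    obtain ⟨i, hi, rfl⟩ := mem_image.mp hc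
    exact ⟨(hA i hi).2, enc_ne_zero_of_redValley (hA i hi).1⟩
  · rw [← hk]
    exact card_image_of_injOn fun a ha b hb =>
      redValley_injOn (tr x.2.1) (hA a ha).1 (hA b hb).1
  · intro c hc
    obtain ⟨i, hi, rfl⟩ := mem_image.mp hc
    exact enc_ne_zero_of_redValley (hB i hi)
  · rw [← hj]
    exact card_image_of_injOn fun a ha b hb => redValley_injOn x.1 (hB a ha) (hB b hb)
  · rw [← hr, ← Yval_tr, ← cum_enc, cum_succ, cum_zero, zero_add]
    rfl

theorem exists_toSeq_eq {m n r k j : ℕ} {z : SeqCand} (hz : IsSeqRPo m n r k j z) :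
    ∃ x : RPoCand m n, IsRPo m n r k j x ∧ toSeq x = z := by
  obtain ⟨f, g, A, B⟩ := z
  obtain ⟨h1, h2, h3, h4, h5, h6, h7, h8, h9, h10⟩ := hz
  simp only at h1 h2 h3 h4 h5 h6 h7 h8 h9 h10
  obtain ⟨red, e1, n1, rfl⟩ := exists_enc (L := m + n) rfl f h1 h2
  obtain ⟨green', e2, n2, rfl⟩ := exists_enc (L := m + n) (add_comm m n) g h3 h4
  obtain ⟨green, rfl⟩ : ∃ green, green' = tr green := ⟨tr green', (tr_tr green').symm⟩
  rw [eBef_tr] at e2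
  set A' := univ.filter fun i : Fin (m + n) =>
    IsRedValley (tr green) i ∧ eBef (tr green) i.1 ∈ A with hA'
  set B' := univ.filter fun i : Fin (m + n) =>
    IsRedValley red i ∧ eBef red i.1 ∈ B with hB'
  have hAi : A'.image (fun i => eBef (tr green) i.1) = A := by
    ext c
    simp only [mem_image, hA', mem_filter, mem_univ, true_and]
    constructor
    · rintro ⟨i, ⟨-, h⟩, rfl⟩; exact h
    · intro hc
      obtain ⟨i, hi, rfl⟩ := exists_redValley (h6 c hc).2
      exact ⟨i, ⟨hi, hc⟩, rfl⟩
  have hBi : B'.image (fun i => eBef red i.1) = B := by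
    ext c
    simp only [mem_image, hB', mem_filter, mem_univ, true_and]
    constructor
    · rintro ⟨i, ⟨-, h⟩, rfl⟩; exact h
    · intro hc
      obtain ⟨i, hi, rfl⟩ := exists_redValley (h8 c hc)
      exact ⟨i, ⟨hi, hc⟩, rfl⟩
  have hAv : ∀ i ∈ A', IsRedValley (tr green) i ∧ eBef (tr green) i.1 ∈ A := fun i hi =>
    (mem_filter.mp hi).2
  have hBv : ∀ i ∈ B', IsRedValley red i ∧ eBef red i.1 ∈ B := fun i hi => (mem_filter.mp hi).2
  refine ⟨(red, green, A', B'), ⟨⟨n1, e2, ?_⟩, ?_, ?_, ?_, ?_, ?_⟩, ?_⟩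
  · apply (above_iff red green (n1.trans e2.symm)).mpr
    rw [n1]
    simpa only [Above, cum_enc, Yval_tr] using h5
  · intro i hi
    rw [greenPeak_iff]
    exact ⟨(hAv i hi).1, (h6 _ (hAv i hi).2).1⟩
  · rw [← h7, ← hAi]
    exact (card_image_of_injOn fun a ha b hb =>
      redValley_injOn (tr green) (hAv a ha).1 (hAv b hb).1).symm
  · exact fun i hi => (hBv i hi).1
  · rw [← h9, ← hBi]
    exact (card_image_of_injOn fun a ha b hb =>
      redValley_injOn red (hBv a ha).1 (hBv b hb).1).symm
  · rw [← h10, ← Yval_tr, ← cum_enc, cum_succ, cum_zero, zero_add]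
  · simp only [toSeq, hAi, hBi]

theorem toSeq_injOn {m n r k j : ℕ} {x y : RPoCand m n} (hx : IsRPo m n r k j x)
    (hy : IsRPo m n r k j y) (h : toSeq x = toSeq y) : x = y := by
  obtain ⟨r1, g1, A1, B1⟩ := x
  obtain ⟨r2, g2, A2, B2⟩ := y
  obtain ⟨⟨h1, h2, -⟩, hA, -, hB, -⟩ := hx
  obtain ⟨⟨h1', h2', -⟩, hA', -, hB', -⟩ := hy
  simp only [toSeq, Prod.mk.injEq] at h hA hA' hB hB' h1 h1' h2 h2'
  obtain ⟨e1, e2, e3, e4⟩ := h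
  have t1 := eBef_add_nBef r1 (k := m + n) le_rfl
  have t2 := eBef_add_nBef r2 (k := m + n) le_rfl
  obtain rfl : r1 = r2 := enc_injective (by omega) e1
  obtain rfl : g1 = g2 := by
    have := enc_injective (by rw [eBef_tr, eBef_tr, h2, h2']) e2
    rw [← tr_tr g1, this, tr_tr]
  simp only [greenPeak_iff] at hA hA'
  rw [image_injOn_subsets (redValley_injOn (tr g1)) (fun a ha => (hA a ha).1)
    (fun a ha => (hA' a ha).1) e3, image_injOn_subsets (redValley_injOn r1) hB hB' e4]

theorem RPoE_natCast (m n r k j : ℕ) : RPoE m n r k j = seqEnum m n r k j := by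
  unfold RPoE seqEnum
  rw [if_pos (by simp)]
  simp only [Int.toNat_natCast]
  refine sum_nbij toSeq ?_ ?_ ?_ ?_
  · intro x hx
    exact mem_seqRPo.mpr (toSeq_mem (mem_filter.mp hx).2)
  · intro x hx y hy h
    rw [mem_coe, mem_filter] at hx hy
    exact toSeq_injOn hx.2 hy.2 h
  · intro z hz
    obtain ⟨x, hx, rfl⟩ := exists_toSeq_eq (mem_seqRPo.mp hz)
    exact ⟨x, by simpa using hx, rfl⟩
  · intro x hx
    rw [seqArea_toSeq (mem_filter.mp hx).2.1, bounce_toSeq (mem_filter.mp hx).2]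

/-! ## Removing the first bounce of a polyomino -/

theorem Above.dual {f g : ℕ → ℕ} {m n : ℕ} (h : Above f g n) (hm : m ≤ cum g (n + 1)) :
    Above g f m := by
  intro c hc
  by_contra hlt
  by_cases hy : cum f (c + 1) < n
  · have h1 := h _ hy
    have h2 := cum_mono f (show cum g (cum f (c + 1) + 1) + 1 ≤ c + 1 by omega)
    omega
  · have := cum_mono g (show n + 1 ≤ cum f (c + 1) + 1 by omega)
    omega

theorem le_corner_snd {f g : ℕ → ℕ} {n : ℕ} (h : Above f g n) (k : ℕ) :
    min k n ≤ (corner f g k).2 := by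
  induction k with
  | zero => simp
  | succ k ih =>
    obtain _ | n := n
    · simp
    simp only [corner]
    have h1 := h (min k n) (by omega)
    have h2 := cum_mono g (show min k n + 1 ≤ (corner f g k).2 + 1 by omega)
    have h3 := cum_mono f (Nat.succ_le_succ h2)
    simp only [Nat.succ_eq_add_one] at h3
    omega

theorem le_corner_fst {f g : ℕ → ℕ} {m : ℕ} (h : Above g f m) (k : ℕ) :
    min k m ≤ (corner f g (k + 1)).1 := by
  induction k with
  | zero => simp
  | succ k ih =>
    obtain _ | m := m
    · simp
    have h1 := h (min k m) (by omega)
    have h2 := cum_mono f (show min k m + 1 ≤ (corner f g (k + 1)).1 + 1 by omega)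
    have h3 := cum_mono g (Nat.succ_le_succ h2)
    simp only [Nat.succ_eq_add_one, corner] at h3 ⊢
    omega

theorem vLab_eq_sum (f g : ℕ → ℕ) (L y : ℕ) :
    vLab f g L y = ∑ i ∈ range L, if (corner f g (i + 1)).2 ≤ y then 1 else 0 := by
  rw [vLab, card_filter, show Finset.Icc 1 L = Finset.Ico 1 (L + 1) from rfl,
    sum_Ico_eq_sum_range]
  exact sum_congr rfl fun i _ => by rw [add_comm 1 i]

theorem hLab_eq_sum (f g : ℕ → ℕ) (L c : ℕ) :
    hLab f g L c = ∑ i ∈ range L, if (corner f g (i + 1)).1 ≤ c then 1 else 0 := by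
  rw [hLab, card_filter, show Finset.Icc 1 L = Finset.Ico 1 (L + 1) from rfl,
    sum_Ico_eq_sum_range]
  exact sum_congr rfl fun i _ => by rw [add_comm 1 i]

theorem vLab_stable {f g : ℕ → ℕ} {n : ℕ} (h : Above f g n) {L L' y : ℕ} (hy : y < n)
    (hL : n ≤ L) (hL' : n ≤ L') : vLab f g L y = vLab f g L' y := by
  unfold vLab
  congr 1
  ext k
  simp only [mem_filter, mem_Icc]
  have := le_corner_snd h k
  omega

theorem hLab_stable {f g : ℕ → ℕ} {m : ℕ} (h : Above g f m) {L L' c : ℕ} (hc : c < m)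
    (hL : m ≤ L) (hL' : m ≤ L') : hLab f g L c = hLab f g L' c := by
  unfold hLab
  congr 1
  ext k
  simp only [mem_filter, mem_Icc]
  obtain _ | k := k
  · simp
  have := le_corner_fst h k
  omega

/-- The polyomino `x`, whose green path starts with `a` east steps, splits into the part `p` of its
red path before the `(a+1)`-st east step, and the reflection `z` of what remains. -/
structure Decomp (a : ℕ) (x : SeqCand) (p : (ℕ → ℕ) × Finset ℕ) (z : SeqCand) : Prop where
  green_zero : x.2.1 0 = a
  green_succ : ∀ c, x.2.1 (c + 1) = z.1 c
  red_low : ∀ c ≤ a, x.1 c = p.1 c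
  supp_low : ∀ c, p.1 c ≠ 0 → c ≤ a
  red_high : ∀ c, x.1 (a + 1 + c) = z.2.1 (c + 1)
  height : cum x.1 (a + 1) = z.2.1 0 + 1
  peak_zero : 0 ∉ x.2.2.1
  peak_succ : ∀ c, c + 1 ∈ x.2.2.1 ↔ c ∈ z.2.2.2
  peak_zero' : 0 ∉ z.2.2.1
  peak_succ' : ∀ c, c + 1 ∈ z.2.2.1 ↔ a + 1 + c ∈ x.2.2.2
  valley_low : ∀ c, c ∈ p.2 ↔ c ∈ x.2.2.2 ∧ c ≤ a

namespace Decomp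

variable {a : ℕ} {x : SeqCand} {p : (ℕ → ℕ) × Finset ℕ} {z : SeqCand}

theorem cum_green (D : Decomp a x p z) (c : ℕ) : cum x.2.1 (c + 1) = cum z.1 c + a := by
  induction c with
  | zero => simp [cum_succ, cum_zero, D.green_zero]
  | succ c ih => rw [cum_succ, ih, D.green_succ, cum_succ]; ring

theorem cum_red (D : Decomp a x p z) (y : ℕ) : cum x.1 (a + 1 + y) = cum z.2.1 (y + 1) + 1 := by
  induction y with
  | zero => simp [cum_succ z.2.1, cum_zero, ← D.height]
  | succ y ih => rw [← add_assoc, cum_succ, ih, D.red_high, cum_succ _ (y + 1)]; ring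

theorem cum_low (D : Decomp a x p z) {c : ℕ} (hc : c ≤ a + 1) : cum x.1 c = cum p.1 c :=
  sum_congr rfl fun i hi => D.red_low i (by have := mem_range.mp hi; omega)

theorem corner_succ (D : Decomp a x p z) (k : ℕ) :
    (corner x.1 x.2.1 (k + 1)).1 = (corner z.1 z.2.1 k).2 + a ∧
      (corner x.1 x.2.1 (k + 1)).2 = (corner z.1 z.2.1 (k + 1)).1 + 1 := by
  have step : ∀ k, (corner x.1 x.2.1 (k + 1)).1 = (corner z.1 z.2.1 k).2 + a →
      (corner x.1 x.2.1 (k + 1)).2 = (corner z.1 z.2.1 (k + 1)).1 + 1 := by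
    intro k hk
    have : (corner x.1 x.2.1 (k + 1)).2 = cum x.1 ((corner x.1 x.2.1 (k + 1)).1 + 1) := rfl
    rw [this, hk, show (corner z.1 z.2.1 k).2 + a + 1 = a + 1 + (corner z.1 z.2.1 k).2 by ring,
      D.cum_red]
    rfl
  refine ⟨?_, step k ?_⟩ <;>
  · induction k with
    | zero => simp [corner, D.cum_green 0, cum_zero]
    | succ k ih =>
      have : (corner x.1 x.2.1 (k + 1 + 1)).1 = cum x.2.1 ((corner x.1 x.2.1 (k + 1)).2 + 1) := rfl
      rw [this, step k ih, D.cum_green]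
      rfl

theorem above_iff (D : Decomp a x p z) {N n : ℕ} (hn : cum x.1 (a + N + 1) = n + 1)
    (hm : cum x.2.1 (n + 1 + 1) = a + N) : Above x.1 x.2.1 (n + 1) ↔ Above z.1 z.2.1 N := by
  have key : Above x.2.1 x.1 (a + N) ↔ Above z.1 z.2.1 N := by
    have e : ∀ y, cum x.2.1 (cum x.1 (a + y + 1) + 1) = cum z.1 (cum z.2.1 (y + 1) + 1) + a := by
      intro y
      rw [show a + y + 1 = a + 1 + y by ring, D.cum_red, D.cum_green]
    constructor
    · intro h y hy
      have := h (a + y) (by omega)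
      rw [e] at this
      omega
    · intro h c hc
      by_cases hca : c < a
      · have h1 := cum_mono x.2.1 (show 1 ≤ cum x.1 (c + 1) + 1 by omega)
        have h2 := D.cum_green 0
        rw [cum_zero, zero_add, zero_add] at h2
        omega
      · obtain ⟨y, rfl⟩ := Nat.exists_eq_add_of_le (not_lt.mp hca)
        have := h y (by omega)
        rw [e]
        omega
  rw [← key]
  exact ⟨fun h => h.dual hm.ge, fun h => h.dual hn.ge⟩

theorem card_peak (D : Decomp a x p z) : x.2.2.1.card = z.2.2.2.card := by
  rw [← card_image_of_injective z.2.2.2 Nat.succ_injective]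
  congr 1
  ext c
  obtain _ | c := c
  · simp [D.peak_zero]
  · simp [D.peak_succ]

theorem card_valley (D : Decomp a x p z) : x.2.2.2.card = p.2.card + z.2.2.1.card := by
  rw [← card_image_of_injective z.2.2.1 (add_right_injective a), ← card_union_of_disjoint]
  · congr 1
    ext c
    simp only [mem_union, mem_image, D.valley_low]
    constructor
    · intro hc
      by_cases h : c ≤ a
      · exact Or.inl ⟨hc, h⟩
      · obtain ⟨d, rfl⟩ := Nat.exists_eq_add_of_le (show a + 1 ≤ c by omega)
        exact Or.inr ⟨d + 1, (D.peak_succ' d).mpr hc, by ring⟩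
    · rintro (h | ⟨d, hd, rfl⟩)
      · exact h.1
      · obtain _ | d := d
        · exact absurd hd D.peak_zero'
        · have := (D.peak_succ' d).mp hd
          rwa [show a + (d + 1) = a + 1 + d by ring]
  · rw [disjoint_left]
    intro c hc hc'
    obtain ⟨d, hd, rfl⟩ := mem_image.mp hc'
    have := ((D.valley_low _).mp hc).2
    obtain rfl : d = 0 := by omega
    exact D.peak_zero' hd

theorem isSeqRPo_iff (D : Decomp a x p z) {N n k j s w : ℕ} (hw : w ≤ j) :
    (IsSeqRPo (a + N) (n + 1) (a + 1) k j x ∧ p.2.card = w ∧ cum x.1 (a + 1) = s) ↔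
      (((cum p.1 (a + 1) = s ∧ ∀ i, p.1 i ≠ 0 → i < a + 1) ∧ p.2.card = w ∧
          ∀ c ∈ p.2, c < a + 1 ∧ p.1 c ≠ 0) ∧
        IsSeqRPo n N s (j - w) k z) := by
  have e1 := D.cum_red N
  have e2 := D.cum_green (n + 1)
  rw [show a + 1 + N = a + N + 1 by ring] at e1
  have e3 := D.card_valley
  have e4 := D.card_peak
  constructor
  · rintro ⟨h, rfl, rfl⟩
    refine ⟨⟨⟨(D.cum_low le_rfl).symm, fun i hi => Nat.lt_succ_of_le (D.supp_low i hi)⟩, rfl, ?_⟩,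
      ⟨?_, ?_, ?_, ?_, ?_, ?_, ?_, ?_, ?_, ?_⟩⟩
    · intro c hc
      obtain ⟨h1, h2⟩ := (D.valley_low c).mp hc
      exact ⟨by omega, by rw [← D.red_low c h2]; exact h.valley c h1⟩
    · have := h.sum_green
      omega
    · intro i hi
      have := h.supp_green (i + 1) (by rwa [D.green_succ])
      omega
    · have := h.sum_red
      omega
    · intro i hi
      obtain _ | i := i
      · omega
      have := h.supp_red (a + 1 + i) (by rwa [D.red_high])
      omega
    · exact (D.above_iff h.sum_red h.sum_green).mp h.above
    · intro c hc
      obtain _ | c := c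
      · exact absurd hc D.peak_zero'
      refine ⟨by omega, ?_⟩
      rw [← D.red_high]
      exact h.valley _ ((D.peak_succ' c).mp hc)
    · have := h.card_valley
      omega
    · intro c hc
      rw [← D.green_succ]
      exact (h.peak _ ((D.peak_succ c).mpr hc)).2
    · have := h.card_peak
      omega
    · exact D.height.symm
  · rintro ⟨⟨⟨h1, h2⟩, h3, h4⟩, h⟩
    have e5 := h.sum_red
    have e6 := h.sum_green
    have e7 : cum x.1 (a + N + 1) = n + 1 := by omega
    have e8 : cum x.2.1 (n + 1 + 1) = a + N := by omega
    refine ⟨⟨e7, ?_, e8, ?_, ?_, ?_, ?_, ?_, ?_, ?_⟩, h3, ?_⟩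
    · intro i hi
      by_cases hia : i ≤ a
      · omega
      obtain ⟨d, rfl⟩ := Nat.exists_eq_add_of_le (show a + 1 ≤ i by omega)
      have := h.supp_green (d + 1) (by rwa [← D.red_high])
      omega
    · intro i hi
      obtain _ | i := i
      · omega
      have := h.supp_red i (by rwa [← D.green_succ])
      omega
    · exact (D.above_iff e7 e8).mpr h.above
    · intro c hc
      obtain _ | c := c
      · exact absurd hc D.peak_zero
      refine ⟨by omega, ?_⟩
      rw [D.green_succ]
      exact h.valley c ((D.peak_succ c).mp hc)
    · have := h.card_valley
      omega
    · intro c hc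
      by_cases hca : c ≤ a
      · rw [D.red_low c hca]
        exact (h4 c ((D.valley_low c).mpr ⟨hc, hca⟩)).2
      · obtain ⟨d, rfl⟩ := Nat.exists_eq_add_of_le (show a + 1 ≤ c by omega)
        rw [D.red_high]
        exact (h.peak _ ((D.peak_succ' d).mpr hc)).2
    · have := h.card_peak
      omega
    · rw [D.green_zero]
    · rw [D.cum_low le_rfl, h1]

theorem seqArea_eq (D : Decomp a x p z) {N n : ℕ} (hn : cum x.1 (a + N + 1) = n + 1) :
    seqArea (a + N) (n + 1) x.1 x.2.1 =
      ∑ c ∈ range (a + 1), cum p.1 c + seqArea n N z.1 z.2.1 := by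
  have g0 : ∀ y, a ≤ cum x.2.1 (y + 1) := fun y => by rw [D.cum_green]; omega
  unfold seqArea
  rw [sum_range_add, sum_range_succ', cum_zero, add_zero]
  congr 1
  · refine sum_congr rfl fun c hc => ?_
    have hca := mem_range.mp hc
    rw [← card_filter, ← D.cum_low (show c + 1 ≤ a + 1 by omega)]
    have hle := cum_mono x.1 (show c + 1 ≤ a + N + 1 by omega)
    rw [← card_range (cum x.1 (c + 1))]
    congr 1
    ext y
    have := g0 y
    simp only [mem_filter, mem_range, card_range]
    omega
  · rw [sum_comm, sum_range_succ', sum_comm]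
    have : ∀ c, ¬ (a + c < cum x.2.1 (0 + 1)) := by
      intro c
      rw [D.cum_green, cum_zero]
      omega
    simp only [this, and_false, if_false, sum_const_zero, add_zero]
    rw [sum_comm]
    refine sum_congr rfl fun y _ => sum_congr rfl fun c _ => ?_
    rw [show a + c + 1 = a + 1 + c by ring, D.cum_red, D.cum_green]
    congr 1
    simp only [eq_iff_iff]
    omega

theorem vLab_zero (D : Decomp a x p z) (L : ℕ) : vLab x.1 x.2.1 L 0 = 0 := by
  rw [vLab_eq_sum]
  refine sum_eq_zero fun i _ => ?_
  rw [(D.corner_succ i).2]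
  simp

theorem vLab_succ (D : Decomp a x p z) (L y : ℕ) :
    vLab x.1 x.2.1 L (y + 1) = hLab z.1 z.2.1 L y := by
  rw [vLab_eq_sum, hLab_eq_sum]
  refine sum_congr rfl fun i _ => ?_
  rw [(D.corner_succ i).2]
  simp

theorem hLab_low (D : Decomp a x p z) (L : ℕ) {c : ℕ} (hc : c < a) :
    hLab x.1 x.2.1 L c = 0 := by
  rw [hLab_eq_sum]
  refine sum_eq_zero fun i _ => ?_
  rw [(D.corner_succ i).1, if_neg (by omega)]

theorem hLab_high (D : Decomp a x p z) (L c : ℕ) :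
    hLab x.1 x.2.1 (L + 1) (a + c) = vLab z.1 z.2.1 L c + 1 := by
  rw [hLab_eq_sum, vLab_eq_sum, sum_range_succ']
  congr 1
  · refine sum_congr rfl fun i _ => ?_
    rw [(D.corner_succ (i + 1)).1]
    congr 1
    simp only [eq_iff_iff]
    omega
  · rw [(D.corner_succ 0).1]
    simp [corner]

theorem vSum_eq (D : Decomp a x p z) {n L L' : ℕ} (h : Above z.2.1 z.1 n)
    (hx : ∀ c ∈ x.2.2.2, x.1 c ≠ 0) (hL : n ≤ L) (hL' : n ≤ L') :
    vSum (n + 1) L x = hSum n L' z := by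
  unfold vSum hSum
  rw [sum_filter, sum_filter, sum_range_succ', D.vLab_zero, ite_self, add_zero]
  refine sum_congr rfl fun y hy => ?_
  rw [D.vLab_succ, hLab_stable h (mem_range.mp hy) hL hL']
  by_cases hs : y < z.2.1 0
  · have : hLab z.1 z.2.1 L' y = 0 := by
      rw [hLab_eq_sum]
      refine sum_eq_zero fun i _ => if_neg ?_
      have : (corner z.1 z.2.1 (i + 1)).1 = cum z.2.1 ((corner z.1 z.2.1 i).2 + 1) := rfl
      have h2 := cum_mono z.2.1 (show 1 ≤ (corner z.1 z.2.1 i).2 + 1 by omega)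
      have h3 : cum z.2.1 1 = z.2.1 0 := by simp [cum]
      omega
    rw [this, ite_self, ite_self]
  · congr 1
    simp only [eq_iff_iff, mem_image, not_iff_not]
    constructor
    · rintro ⟨b, hb, hy'⟩
      by_cases hba : b ≤ a
      · have h1 := cum_mono x.1 (show b + 1 ≤ a + 1 by omega)
        rw [cum_succ] at h1
        have h2 := hx b hb
        have h3 := D.height
        omega
      · obtain ⟨d, rfl⟩ := Nat.exists_eq_add_of_le (show a + 1 ≤ b by omega)
        refine ⟨d + 1, (D.peak_succ' d).mpr hb, ?_⟩
        rw [D.cum_red] at hy'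
        omega
    · rintro ⟨b, hb, rfl⟩
      obtain _ | d := b
      · exact absurd hb D.peak_zero'
      · exact ⟨a + 1 + d, (D.peak_succ' d).mp hb, D.cum_red d⟩

theorem hSum_eq (D : Decomp a x p z) {n N L L' : ℕ} (h : Above z.1 z.2.1 N)
    (hz : ∀ c ∈ z.2.2.2, z.1 c ≠ 0) (hs : ∀ c, z.1 c ≠ 0 → c < n + 1) (hN : cum z.1 (n + 1) = N)
    (hL : N ≤ L) (hL' : N ≤ L') :
    hSum (a + N) (L + 1) x = vSum N L' z + (N - z.2.2.2.card) := by
  have hlt : ∀ b ∈ z.2.2.2, ∀ c, b < c → cum z.1 b < cum z.1 c := by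
    intro b hb c hbc
    have h1 := cum_mono z.1 (show b + 1 ≤ c by omega)
    rw [cum_succ] at h1
    have := hz b hb
    omega
  have hinj : Set.InjOn (cum z.1) z.2.2.2 := by
    intro b hb c hc hbc
    rcases lt_trichotomy b c with h1 | h1 | h1
    · have := hlt b hb c h1; omega
    · exact h1
    · have := hlt c hc b h1; omega
  have hcard : ((range N).filter fun c => c ∉ z.2.2.2.image (cum z.1)).card =
      N - z.2.2.2.card := by
    rw [← sdiff_eq_filter, card_sdiff_of_subset, card_range, card_image_of_injOn hinj]
    intro c hc
    obtain ⟨b, hb, rfl⟩ := mem_image.mp hc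
    rw [mem_range, ← hN]
    exact hlt b hb _ (hs b (hz b hb))
  rw [← hcard]
  unfold vSum hSum
  rw [sum_filter, sum_range_add, sum_eq_zero, zero_add, ← sum_filter, card_eq_sum_ones,
    ← sum_add_distrib]
  · refine sum_congr ?_ fun c hc => ?_
    · refine filter_congr fun c _ => ?_
      rw [not_iff_not]
      simp only [mem_image]
      constructor
      · rintro ⟨b, hb, he⟩
        obtain _ | b := b
        · exact absurd hb D.peak_zero
        · refine ⟨b, (D.peak_succ b).mp hb, ?_⟩
          rw [D.cum_green] at he
          omega
      · rintro ⟨b, hb, rfl⟩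
        exact ⟨b + 1, (D.peak_succ b).mpr hb, by rw [D.cum_green, add_comm]⟩
    · rw [D.hLab_high, vLab_stable h (mem_range.mp (mem_filter.mp hc).1) hL hL']
  · intro c hc
    rw [D.hLab_low _ (mem_range.mp hc), ite_self]

theorem right_unique {p' : (ℕ → ℕ) × Finset ℕ} {z' : SeqCand} (D : Decomp a x p z)
    (D' : Decomp a x p' z') : p = p' ∧ z = z' := by
  refine ⟨Prod.ext (funext fun c => ?_) ?_, Prod.ext (funext fun c => ?_)
    (Prod.ext (funext fun c => ?_) (Prod.ext ?_ ?_))⟩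
  · by_cases hc : c ≤ a
    · rw [← D.red_low c hc, D'.red_low c hc]
    · have h1 := mt (D.supp_low c) hc
      have h2 := mt (D'.supp_low c) hc
      omega
  · ext c
    rw [D.valley_low, D'.valley_low]
  · rw [← D.green_succ, D'.green_succ]
  · obtain _ | c := c
    · have h1 := D.height
      have h2 := D'.height
      omega
    · rw [← D.red_high, D'.red_high]
  · ext c
    obtain _ | c := c
    · simp [D.peak_zero', D'.peak_zero']
    · rw [D.peak_succ', D'.peak_succ']
  · ext c
    rw [← D.peak_succ, D'.peak_succ]

theorem left_unique {x' : SeqCand} (D : Decomp a x p z) (D' : Decomp a x' p z) : x = x' := by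
  refine Prod.ext (funext fun c => ?_) (Prod.ext (funext fun c => ?_) (Prod.ext ?_ ?_))
  · by_cases hc : c ≤ a
    · rw [D.red_low c hc, D'.red_low c hc]
    · obtain ⟨d, rfl⟩ := Nat.exists_eq_add_of_le (show a + 1 ≤ c by omega)
      rw [D.red_high, D'.red_high]
  · obtain _ | c := c
    · rw [D.green_zero, D'.green_zero]
    · rw [D.green_succ, D'.green_succ]
  · ext c
    obtain _ | c := c
    · simp [D.peak_zero, D'.peak_zero]
    · rw [D.peak_succ, D'.peak_succ]
  · ext c
    by_cases hc : c ≤ a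
    · have h1 := D.valley_low c
      have h2 := D'.valley_low c
      tauto
    · obtain ⟨d, rfl⟩ := Nat.exists_eq_add_of_le (show a + 1 ≤ c by omega)
      rw [← D.peak_succ', ← D'.peak_succ']

end Decomp

/-- The two parts of a polyomino in `Decomp`. -/
def split (a : ℕ) (x : SeqCand) : ((ℕ → ℕ) × Finset ℕ) × SeqCand :=
  ((fun c => if c ≤ a then x.1 c else 0, x.2.2.2.filter (· ≤ a)),
    (fun c => x.2.1 (c + 1), fun c => if c = 0 then cum x.1 (a + 1) - 1 else x.1 (a + c),
      (x.2.2.2.filter (a < ·)).image (· - a), (x.2.2.1.filter (· ≠ 0)).image (· - 1)))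

theorem decomp_split {m n k j a : ℕ} {x : SeqCand} (hx : IsSeqRPo m (n + 1) (a + 1) k j x) :
    Decomp a x (split a x).1 (split a x).2 := by
  have hg : x.2.1 0 = a := by have := hx.first_run; omega
  refine ⟨hg, fun c => rfl, ?_, ?_, ?_, ?_, ?_, ?_, ?_, ?_, ?_⟩
  · intro c hc
    simp [split, hc]
  · intro c hc
    by_contra h
    simp [split, h] at hc
  · intro c
    simp [split, add_assoc, add_comm 1 c]
  · have := hx.above 0 (by omega)
    rw [cum_succ x.2.1, cum_zero, zero_add, hg, zero_add] at this
    simp only [split, if_true]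
    omega
  · exact fun h => (hx.peak 0 h).1 rfl
  · intro c
    simp only [split, mem_image, mem_filter]
    constructor
    · exact fun h => ⟨c + 1, ⟨h, by omega⟩, by omega⟩
    · rintro ⟨d, ⟨h, h0⟩, rfl⟩
      rwa [show d - 1 + 1 = d by omega]
  · simp only [split, mem_image, mem_filter]
    rintro ⟨d, ⟨h, h0⟩, h1⟩
    omega
  · intro c
    simp only [split, mem_image, mem_filter]
    constructor
    · rintro ⟨d, ⟨h, h0⟩, h1⟩
      rwa [show a + 1 + c = d by omega]
    · exact fun h => ⟨a + 1 + c, ⟨h, by omega⟩, by omega⟩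
  · intro c
    simp [split]

theorem exists_decomp {a : ℕ} {p : (ℕ → ℕ) × Finset ℕ} {z : SeqCand}
    (h1 : ∀ i, p.1 i ≠ 0 → i ≤ a) (h2 : ∀ i ∈ p.2, i ≤ a) (h3 : cum p.1 (a + 1) = z.2.1 0 + 1)
    (h4 : 0 ∉ z.2.2.1) : ∃ x, Decomp a x p z := by
  refine ⟨(fun c => if c ≤ a then p.1 c else z.2.1 (c - a),
    fun c => if c = 0 then a else z.1 (c - 1), z.2.2.2.image (· + 1),
    p.2 ∪ z.2.2.1.image (· + a)), by simp, by simp, ?_, h1, ?_, ?_, by simp, by simp, h4, ?_, ?_⟩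
  · intro c hc
    simp [hc]
  · intro c
    simp [show ¬ (a + 1 + c ≤ a) by omega, show a + 1 + c - a = c + 1 by omega]
  · rw [← h3]
    refine sum_congr rfl fun c hc => ?_
    have := mem_range.mp hc
    simp [show c ≤ a by omega]
  · intro c
    simp only [mem_union, mem_image]
    constructor
    · exact fun h => Or.inr ⟨c + 1, h, by ring⟩
    · rintro (h | ⟨d, h, he⟩)
      · have := h2 _ h
        omega
      · rwa [show c + 1 = d by omega]
  · intro c
    simp only [mem_union, mem_image]
    constructor
    · exact fun h => ⟨Or.inl h, h2 c h⟩
    · rintro ⟨h | ⟨d, h, rfl⟩, hc⟩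
      · exact h
      · obtain rfl : d = 0 := by omega
        exact absurd h h4

/-! ## Gaussian binomials as generating functions -/

theorem qBinom_zero_right (N : ℕ) : qBinom N 0 = 1 := by cases N <;> rfl

theorem qBinom_succ (N k : ℕ) :
    qBinom (N + 1) (k + 1) = qBinom N k + qv ^ (k + 1) * qBinom N (k + 1) := rfl

theorem qBinom_eq_zero {N k : ℕ} (h : N < k) : qBinom N k = 0 := by
  induction N generalizing k with
  | zero =>
    obtain _ | k := k
    · omega
    · rfl
  | succ N ih =>
    obtain _ | k := k
    · omega
    · rw [qBinom_succ, ih (by omega), ih (by omega), mul_zero, add_zero]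

/-- The area to the left of the line `x = r - 1` below a path with column heights `f`. -/
def lowArea (r : ℕ) (f : ℕ → ℕ) : ℕ := ∑ c ∈ range r, cum f c

theorem lowArea_succ (r : ℕ) (f : ℕ → ℕ) : lowArea (r + 1) f = lowArea r f + cum f r :=
  sum_range_succ _ _

theorem lowArea_add (r : ℕ) (f g : ℕ → ℕ) :
    lowArea r (fun i => f i + g i) = lowArea r f + lowArea r g := by
  simp only [lowArea, cum, sum_add_distrib]

theorem lowArea_congr {r : ℕ} {f g : ℕ → ℕ} (h : ∀ i < r, f i = g i) :
    lowArea (r + 1) f = lowArea (r + 1) g := by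
  refine sum_congr rfl fun c hc => sum_congr rfl fun i hi => h i ?_
  have := mem_range.mp hc
  have := mem_range.mp hi
  omega

theorem sum_piAntidiag_lowArea (r d : ℕ) :
    ∑ f ∈ piAntidiag (range r) d, qv ^ lowArea r f = qBinom (r + d - 1) d := by
  induction r generalizing d with
  | zero =>
    obtain _ | d := d
    · simp [lowArea, qBinom_zero_right]
    · rw [qBinom_eq_zero (by omega), range_zero, piAntidiag_empty_of_ne_zero (by omega), sum_empty]
  | succ r ihr =>
    induction d with
    | zero => simp [lowArea, cum, qBinom_zero_right]
    | succ d ihd =>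
      rw [show r + 1 + (d + 1) - 1 = (r + d) + 1 by omega, qBinom_succ,
        ← sum_filter_not_add_sum_filter _ (fun f : ℕ → ℕ => f r = 0)]
      have hup : ∀ (f : ℕ → ℕ) v, ∑ i ∈ range r, Function.update f r v i = ∑ i ∈ range r, f i :=
        fun f v => sum_congr rfl fun i hi => Function.update_of_ne (mem_range.mp hi).ne v f
      congr 1
      · rw [show r + d = r + 1 + d - 1 by omega, ← ihd]
        refine sum_nbij' (fun f => Function.update f r (f r - 1))
          (fun f => Function.update f r (f r + 1)) ?_ ?_ ?_ ?_ ?_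
        · intro f hf
          simp only [mem_filter, mem_piAntidiag, sum_range_succ] at hf ⊢
          obtain ⟨⟨h1, h2⟩, h3⟩ := hf
          constructor
          · rw [hup, Function.update_self]
            change cum f r + f r = d + 1 at h1
            change cum f r + (f r - 1) = d
            omega
          · intro i hi
            by_cases hir : i = r
            · simp [hir]
            · exact h2 i (by rwa [Function.update_of_ne hir] at hi)
        · intro f hf
          simp only [mem_filter, mem_piAntidiag, sum_range_succ] at hf ⊢
          obtain ⟨h1, h2⟩ := hf
          refine ⟨⟨?_, ?_⟩, by simp⟩
          · rw [hup, Function.update_self]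
            exact congrArg (· + 1) h1
          · intro i hi
            by_cases hir : i = r
            · simp [hir]
            · exact h2 i (by rwa [Function.update_of_ne hir] at hi)
        · intro f hf
          have := (mem_filter.mp hf).2
          simp [show f r - 1 + 1 = f r by omega]
        · intro f _
          simp
        · intro f _
          congr 1
          exact lowArea_congr fun i hi => (Function.update_of_ne (by omega) _ f).symm
      · have : (piAntidiag (range (r + 1)) (d + 1)).filter (fun f : ℕ → ℕ => f r = 0) =
            piAntidiag (range r) (d + 1) := by
          ext f
          simp only [mem_filter, mem_piAntidiag, sum_range_succ, mem_range]
          constructor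
          · rintro ⟨⟨h1, h2⟩, h3⟩
            rw [h3] at h1
            refine ⟨h1, fun i hi => ?_⟩
            have := h2 i hi
            have : i ≠ r := by rintro rfl; exact hi h3
            omega
          · rintro ⟨h1, h2⟩
            have h3 : f r = 0 := by
              by_contra h
              exact absurd (h2 r h) (lt_irrefl r)
            exact ⟨⟨by rw [h3]; exact h1, fun i hi => (h2 i hi).trans (by omega)⟩, h3⟩
        rw [this, show r + d = r + (d + 1) - 1 by omega, ← ihr, mul_sum]
        refine sum_congr rfl fun f hf => ?_
        rw [lowArea_succ, cum, (mem_piAntidiag.mp hf).1, pow_add, mul_comm]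

/-- The indicator function of a finite set. -/
def ind (B : Finset ℕ) (i : ℕ) : ℕ := if i ∈ B then 1 else 0

theorem cum_ind {B : Finset ℕ} {r : ℕ} (hB : B ⊆ range r) : cum (ind B) r = B.card := by
  unfold cum ind
  rw [← card_filter, filter_mem_eq_inter, inter_eq_right.mpr hB]

theorem sum_powersetCard_lowArea (r w : ℕ) :
    ∑ B ∈ powersetCard w (range r), qv ^ lowArea r (ind B) =
      qv ^ (w * (w - 1) / 2) * qBinom r w := by
  induction r generalizing w with
  | zero =>
    obtain _ | w := w
    · simp [lowArea, qBinom_zero_right]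
    · rw [qBinom_eq_zero (by omega), powersetCard_eq_empty.mpr (by simp), sum_empty, mul_zero]
  | succ r ih =>
    obtain _ | w := w
    · simp [lowArea, cum, ind, qBinom_zero_right]
    · have hr : r ∉ range r := by simp
      have hnot : ∀ {v} {B : Finset ℕ}, B ∈ powersetCard v (range r) → r ∉ B := fun hB h =>
        hr ((mem_powersetCard.mp hB).1 h)
      rw [range_add_one, powersetCard_succ_insert hr, sum_union, sum_image]
      · have h1 : ∀ v, ∀ B ∈ powersetCard v (range r),
            lowArea (r + 1) (ind B) = v + lowArea r (ind B) := by
          intro v B hB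
          obtain ⟨h2, h3⟩ := mem_powersetCard.mp hB
          rw [lowArea_succ, cum_ind h2, h3, add_comm]
        have h2 : ∀ B ∈ powersetCard w (range r),
            lowArea (r + 1) (ind (insert r B)) = w + lowArea r (ind B) := by
          intro B hB
          rw [← h1 w B hB]
          refine lowArea_congr fun i hi => ?_
          simp [ind, hi.ne]
        rw [sum_congr rfl fun B hB => by rw [h1 _ B hB, pow_add],
          sum_congr (s₁ := powersetCard w (range r)) rfl fun B hB => by rw [h2 B hB, pow_add],
          ← mul_sum, ← mul_sum, ih, ih, qBinom_succ]
        have h3 : (w + 1) * (w + 1 - 1) / 2 = w * (w - 1) / 2 + w := by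
          obtain _ | v := w
          · rfl
          · rw [show (v + 1 + 1) * (v + 1 + 1 - 1) = (v + 1) * (v + 1 - 1) + (v + 1) * 2 by
              simp; ring, Nat.add_mul_div_right _ _ (by omega)]
        rw [h3, pow_add, Nat.succ_eq_add_one]
        ring
      · intro B hB B' hB' h
        rw [← erase_insert (hnot hB), ← erase_insert (hnot hB'), h]
      · rw [disjoint_left]
        intro B hB hB'
        obtain ⟨B', -, rfl⟩ := mem_image.mp hB'
        exact hnot hB (mem_insert_self r B')

/-- Initial parts of a red path: column heights `p.1` with sum `s` in the first `r` columns,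
together with a set `p.2` of `w` decorated nonempty columns. -/
def lowParts (r s w : ℕ) : Finset ((ℕ → ℕ) × Finset ℕ) :=
  (piAntidiag (range r) s ×ˢ powersetCard w (range r)).filter fun p => ∀ c ∈ p.2, p.1 c ≠ 0

theorem mem_lowParts {r s w : ℕ} {p : (ℕ → ℕ) × Finset ℕ} :
    p ∈ lowParts r s w ↔ (cum p.1 r = s ∧ ∀ i, p.1 i ≠ 0 → i < r) ∧ p.2.card = w ∧
      ∀ c ∈ p.2, c < r ∧ p.1 c ≠ 0 := by
  simp only [lowParts, mem_filter, mem_product, mem_piAntidiag, mem_powersetCard, mem_range,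
    subset_iff, cum]
  constructor
  · rintro ⟨⟨h1, h2, h3⟩, h4⟩
    exact ⟨h1, h3, fun c hc => ⟨h2 hc, h4 c hc⟩⟩
  · rintro ⟨h1, h3, h4⟩
    exact ⟨⟨h1, fun c hc => (h4 c hc).1, h3⟩, fun c hc => (h4 c hc).2⟩

theorem sum_lowParts (r s w : ℕ) :
    ∑ p ∈ lowParts r s w, qv ^ lowArea r p.1 =
      qv ^ (w * (w - 1) / 2) * qBinom r w *
        if w ≤ s then qBinom (r + (s - w) - 1) (s - w) else 0 := by
  unfold lowParts
  rw [sum_filter, sum_product_right, ← sum_powersetCard_lowArea, sum_mul]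
  refine sum_congr rfl fun B hB => ?_
  obtain ⟨hBr, hBw⟩ := mem_powersetCard.mp hB
  rw [← sum_filter]
  have hle : ∀ f : ℕ → ℕ, (∀ c ∈ B, f c ≠ 0) → ∀ i, ind B i ≤ f i := by
    intro f hf i
    unfold ind
    split_ifs with h
    · exact Nat.one_le_iff_ne_zero.mpr (hf i h)
    · exact Nat.zero_le _
  have hcum : ∀ f : ℕ → ℕ, cum (fun i => f i + ind B i) r = cum f r + w := by
    intro f
    rw [← hBw, ← cum_ind hBr]
    exact sum_add_distrib
  split_ifs with hws
  · rw [← sum_piAntidiag_lowArea, mul_sum]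
    refine sum_nbij' (fun f i => f i - ind B i) (fun f i => f i + ind B i) ?_ ?_ ?_ ?_ ?_
    · intro f hf
      simp only [mem_filter, mem_piAntidiag] at hf ⊢
      obtain ⟨⟨h1, h2⟩, h3⟩ := hf
      refine ⟨?_, fun i hi => h2 i (by omega)⟩
      change cum (fun i => f i - ind B i) r = s - w
      change cum f r = s at h1
      have h4 := hcum fun i => f i - ind B i
      rw [show (fun i => f i - ind B i + ind B i) = f from
        funext fun i => Nat.sub_add_cancel (hle f h3 i)] at h4
      omega
    · intro f hf
      simp only [mem_filter, mem_piAntidiag] at hf ⊢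
      obtain ⟨h1, h2⟩ := hf
      refine ⟨⟨?_, fun i hi => ?_⟩, fun c hc => by simp [ind, hc]⟩
      · change cum f r = s - w at h1
        exact (hcum f).trans (by omega)
      · by_cases hiB : i ∈ B
        · exact hBr hiB
        · exact h2 i (by simpa [ind, hiB] using hi)
    · intro f hf
      exact funext fun i => Nat.sub_add_cancel (hle f (mem_filter.mp hf).2 i)
    · intro f _
      exact funext fun i => Nat.add_sub_cancel (f i) (ind B i)
    · intro f hf
      rw [← pow_add, ← lowArea_add]
      congr 2
      exact funext fun i => (Nat.add_sub_cancel' (hle f (mem_filter.mp hf).2 i)).symm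
  · rw [mul_zero]
    refine sum_eq_zero fun f hf => ?_
    simp only [mem_filter, mem_piAntidiag] at hf
    have h1 : cum (ind B) r ≤ cum f r := sum_le_sum fun i _ => hle f hf.2 i
    rw [cum_ind hBr, hBw] at h1
    exact absurd (h1.trans hf.1.1.le) hws

/-! ## The recursion -/

theorem sum_fiber (a N n k j w s : ℕ) (hw : w ≤ j) :
    ∑ x ∈ ((seqRPo (a + N) (n + 1) (a + 1) k j).filter
        fun x => (x.2.2.2.filter (· ≤ a)).card = w).filter fun x => cum x.1 (a + 1) = s,
      qv ^ seqArea (a + N) (n + 1) x.1 x.2.1 *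
        tv ^ (vSum (n + 1) (a + N + (n + 1)) x + hSum (a + N) (a + N + (n + 1)) x) =
    tv ^ (N - k) *
      ((∑ p ∈ lowParts (a + 1) s w, qv ^ lowArea (a + 1) p.1) * seqEnum n N s (j - w) k) := by
  unfold seqEnum
  rw [sum_mul_sum, ← sum_product', mul_sum]
  have hmem : ∀ x, x ∈ ((seqRPo (a + N) (n + 1) (a + 1) k j).filter
        fun x => (x.2.2.2.filter (· ≤ a)).card = w).filter (fun x => cum x.1 (a + 1) = s) ↔
      IsSeqRPo (a + N) (n + 1) (a + 1) k j x ∧ (x.2.2.2.filter (· ≤ a)).card = w ∧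
        cum x.1 (a + 1) = s := by
    intro x
    rw [mem_filter, mem_filter, mem_seqRPo, and_assoc]
  refine sum_nbij (split a) ?_ ?_ ?_ ?_
  · intro x hx
    rw [hmem] at hx
    have D := decomp_split hx.1
    have := (D.isSeqRPo_iff hw).mp hx
    rw [mem_product, mem_lowParts, mem_seqRPo]
    exact this
  · intro x hx y hy hxy
    rw [mem_coe, hmem] at hx hy
    have D := decomp_split hx.1
    rw [hxy] at D
    exact D.left_unique (decomp_split hy.1)
  · rintro ⟨p, z⟩ hpz
    rw [mem_coe, mem_product, mem_lowParts, mem_seqRPo] at hpz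
    obtain ⟨⟨⟨h1, h2⟩, h3, h4⟩, hz⟩ := hpz
    obtain ⟨x, D⟩ := exists_decomp (a := a) (p := p) (z := z)
      (fun i hi => Nat.le_of_lt_succ (h2 i hi)) (fun i hi => Nat.le_of_lt_succ (h4 i hi).1)
      (h1.trans hz.first_run.symm) (fun h => (hz.peak 0 h).1 rfl)
    have hx := (D.isSeqRPo_iff hw).mpr ⟨⟨⟨h1, h2⟩, h3, h4⟩, hz⟩
    obtain ⟨e1, e2⟩ := (decomp_split hx.1).right_unique D
    refine ⟨x, ?_, Prod.ext e1 e2⟩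
    rw [mem_coe, hmem]
    refine ⟨hx.1, ?_, hx.2.2⟩
    rw [← hx.2.1, ← e1]
    rfl
  · intro x hx
    rw [hmem] at hx
    have D := decomp_split hx.1
    have hz := ((D.isSeqRPo_iff hw).mp hx).2
    rw [D.seqArea_eq hx.1.sum_red, D.vSum_eq (L' := n + N) (hz.above.dual hz.sum_green.ge)
        hx.1.valley (by omega) (by omega), ← add_assoc (a + N) n 1,
      D.hSum_eq (L' := n + N) hz.above hz.valley hz.supp_red hz.sum_red (by omega) (by omega),
      hz.card_valley, pow_add, pow_add, pow_add, pow_add]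
    unfold lowArea
    ring

theorem seqEnum_recursion (a N n k j : ℕ) :
    seqEnum (a + N) (n + 1) (a + 1) k j =
      tv ^ (N - k) * ∑ w ∈ range (a + 1 + 1), ∑ s ∈ range (n + 1 + 1),
        (∑ p ∈ lowParts (a + 1) s w, qv ^ lowArea (a + 1) p.1) *
          if w ≤ j then seqEnum n N s (j - w) k else 0 := by
  conv_lhs => unfold seqEnum
  rw [← sum_fiberwise_of_maps_to (t := range (a + 1 + 1))
    (g := fun x : SeqCand => (x.2.2.2.filter (· ≤ a)).card), mul_sum]
  · refine sum_congr rfl fun w _ => ?_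
    rw [← sum_fiberwise_of_maps_to (t := range (n + 1 + 1))
      (g := fun x : SeqCand => cum x.1 (a + 1)), mul_sum]
    · refine sum_congr rfl fun s _ => ?_
      split_ifs with hw
      · exact sum_fiber a N n k j w s hw
      · rw [mul_zero, mul_zero, sum_eq_zero]
        intro x hx
        rw [mem_filter, mem_filter, mem_seqRPo] at hx
        have h1 := card_filter_le x.2.2.2 (· ≤ a)
        rw [hx.1.1.card_valley, hx.1.2] at h1
        exact absurd h1 hw
    · intro x hx
      have hx' := mem_seqRPo.mp (mem_filter.mp hx).1
      rw [mem_range, Nat.lt_succ_iff, ← hx'.sum_red]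
      exact cum_mono x.1 (by omega)
  · intro x _
    have h : x.2.2.2.filter (· ≤ a) ⊆ range (a + 1) := fun c hc =>
      mem_range.mpr (Nat.lt_succ_of_le (mem_filter.mp hc).2)
    exact mem_range.mpr (Nat.lt_succ_of_le ((card_le_card h).trans_eq (card_range _)))

theorem qBinomZ_natCast (N k : ℕ) : qBinomZ N k = qBinom N k := by
  unfold qBinomZ
  split_ifs with h
  · simp
  · rw [qBinom_eq_zero (by omega)]

theorem qBinomZ_of_neg {N k : ℤ} (h : k < 0) : qBinomZ N k = 0 :=
  if_neg (by omega)

theorem seqEnum_zero (a N k j : ℕ) (hN : 0 < N) : seqEnum (a + N) 0 (a + 1) k j = 0 := by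
  refine sum_eq_zero fun x hx => ?_
  have h := mem_seqRPo.mp hx
  have h1 := h.sum_green
  have h2 := h.first_run
  rw [cum_succ, cum_zero] at h1
  omega

/-- The recursion for the `(area, bounce)` q,t-enumerators of
doubly decorated reduced polyominoes. -/
theorem RPo_recursion (m n k j r : ℤ)
    (hm : 0 ≤ m) (hn : 0 ≤ n) (hk : 0 ≤ k) (hj : 0 ≤ j)
    (hr1 : 1 ≤ r) (hrm : r ≤ m) (hrk : r + k ≤ m + 1) :
    RPoE m n r k j =
      tv ^ (m - r - k + 1).toNat *
        ∑ w ∈ Finset.range (r.toNat + 1), ∑ s ∈ Finset.range (n.toNat + 1),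
          qv ^ (w * (w - 1) / 2) * qBinomZ r (w : ℤ) *
            qBinomZ (r + (s : ℤ) - (w : ℤ) - 1) ((s : ℤ) - (w : ℤ)) *
              RPoE (n - 1) (m - r + 1) (s : ℤ) (j - (w : ℤ)) k := by
  obtain ⟨a, rfl⟩ : ∃ a : ℕ, r = (a : ℤ) + 1 := ⟨(r - 1).toNat, by omega⟩
  obtain ⟨N, rfl⟩ : ∃ N : ℕ, m = (a : ℤ) + N := ⟨(m - a).toNat, by omega⟩
  lift k to ℕ using hk
  lift j to ℕ using hj
  lift n to ℕ using hn
  have hL := RPoE_natCast (a + N) n (a + 1) k j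
  push_cast at hL
  rw [hL]
  obtain _ | n := n
  · rw [seqEnum_zero a N k j (by omega)]
    simp [RPoE]
  · rw [seqEnum_recursion, show ((a : ℤ) + N - (a + 1) - k + 1).toNat = N - k by omega,
      show ((a : ℤ) + 1).toNat = a + 1 by omega, Int.toNat_natCast]
    refine congrArg _ (sum_congr rfl fun w _ => sum_congr rfl fun s _ => ?_)
    rw [sum_lowParts]
    have h1 := qBinomZ_natCast (a + 1) w
    push_cast at h1
    rw [h1]
    congr 1
    · congr 1
      split_ifs with hws
      · rw [← qBinomZ_natCast]
        congr 1 <;> omega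
      · rw [qBinomZ_of_neg (by omega)]
    · rw [show ((n + 1 : ℕ) : ℤ) - 1 = n by omega, show (a : ℤ) + N - (a + 1) + 1 = N by ring]
      split_ifs with hwj
      · rw [← RPoE_natCast, Nat.cast_sub hwj]
      · exact (if_neg (by omega)).symm
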